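/- Assume ‖x_i‖₂ ≤ L for all i ∈ [n]. Then the function G(w) = (1/2n)·Tr(X ((1/σ²) Xᵀ D(w) X + λI)⁻¹ Xᵀ) is L_G-smooth on ℝ₊ⁿ with smoothness constant L_G ≤ n L⁶/(λ³ σ⁴), i.e., the maximum eigenvalue of its Hessian is bounded by n L⁶/(λ³ σ⁴). -/

import Mathlib

open Matrix

lemma aux_second_deriv {E R : Type*} [NormedAddCommGroup E] [NormedSpace ℝ E]
    [FiniteDimensional ℝ E] [NormedRing R] [NormedAlgebra ℝ R] [FiniteDimensional ℝ R]
    (T : R →ₗ[ℝ] ℝ) (B : E →ₗ[ℝ] R) (c : R) (w v : E) (hw : IsUnit (B w + c)) :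
    fderiv ℝ (fun u => fderiv ℝ (fun x => T (Ring.inverse (B x + c))) u v) w v =
      2 * T (Ring.inverse (B w + c) * B v * Ring.inverse (B w + c) * B v *
        Ring.inverse (B w + c)) := by
  haveI : CompleteSpace R := FiniteDimensional.complete ℝ R
  obtain ⟨T', hT'⟩ : ∃ T' : R →L[ℝ] ℝ, ∀ x, T' x = T x :=
    ⟨LinearMap.toContinuousLinearMap T, fun x => rfl⟩
  obtain ⟨B', hB'⟩ : ∃ B' : E →L[ℝ] R, ∀ x, B' x = B x :=
    ⟨LinearMap.toContinuousLinearMap B, fun x => rfl⟩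
  simp only [← hT', ← hB'] at hw ⊢
  have key : ∀ u, IsUnit (B' u + c) → ∃ F : E →L[ℝ] R,
      HasFDerivAt (fun x => Ring.inverse (B' x + c)) F u ∧
      ∀ z, F z = -(Ring.inverse (B' u + c) * B' z * Ring.inverse (B' u + c)) := by
    intro u hu
    obtain ⟨U, hU⟩ := hu
    have h1 : HasFDerivAt (fun x => B' x + c) B' u := B'.hasFDerivAt.add_const c
    have h2 := hasFDerivAt_ringInverse (𝕜 := ℝ) U
    rw [hU] at h2
    have h3 : HasFDerivAt (fun x => Ring.inverse (B' x + c)) _ u :=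
      HasFDerivAt.comp (g := Ring.inverse) u h2 h1
    refine ⟨_, h3, fun z => ?_⟩
    rw [← hU]
    simp [mul_assoc]
  have hev : ∀ᶠ u in nhds w, IsUnit (B' u + c) := by
    have hc : Continuous (fun u => B' u + c) := by fun_prop
    exact (Units.isOpen.preimage hc).mem_nhds hw
  have heq : (fun u => fderiv ℝ (fun x => T' (Ring.inverse (B' x + c))) u v) =ᶠ[nhds w]
      (fun u => T' (-(Ring.inverse (B' u + c) * B' v * Ring.inverse (B' u + c)))) := by
    filter_upwards [hev] with u hu
    obtain ⟨F, hF, hF'⟩ := key u hu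
    have h := T'.hasFDerivAt.comp u hF
    have h' : fderiv ℝ (fun x => T' (Ring.inverse (B' x + c))) u = T'.comp F := h.fderiv
    rw [h']
    simp [hF']
  rw [heq.fderiv_eq]
  obtain ⟨F, hF, hF'⟩ := key w hw
  have h3 := T'.hasFDerivAt.comp w ((hF.mul_const' (B' v)).mul' hF).neg
  have h4 : fderiv ℝ (fun u => T' (-(Ring.inverse (B' u + c) * B' v *
    Ring.inverse (B' u + c)))) w = _ := h3.fderiv
  rw [h4]
  simp [hF', mul_assoc]
  ring

lemma aux_entry {n d : ℕ} (X : Matrix (Fin n) (Fin d) ℝ) (s lam L : ℝ) (hs : 0 ≤ s)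
    (hlam : 0 < lam) (hL : ∀ i, Real.sqrt (∑ j, X i j ^ 2) ≤ L) (w : Fin n → ℝ) (hw : 0 ≤ w) :
    IsUnit (s • (Xᵀ * Matrix.diagonal w * X) + lam • (1 : Matrix (Fin d) (Fin d) ℝ)) ∧
    ∀ i j, |(X * (s • (Xᵀ * Matrix.diagonal w * X) +
      lam • (1 : Matrix (Fin d) (Fin d) ℝ))⁻¹ * Xᵀ) i j| ≤ L ^ 2 / lam := by
  set M := s • (Xᵀ * Matrix.diagonal w * X) + lam • (1 : Matrix (Fin d) (Fin d) ℝ) with hM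
  have hq : ∀ y : Fin d → ℝ, lam * (y ⬝ᵥ y) ≤ y ⬝ᵥ (M *ᵥ y) := by
    intro y
    have h0 : 0 ≤ (X *ᵥ y) ⬝ᵥ (Matrix.diagonal w *ᵥ (X *ᵥ y)) := by
      simp only [dotProduct, mulVec_diagonal]
      refine Finset.sum_nonneg fun i _ => ?_
      have := hw i
      simp only [Pi.zero_apply] at this
      nlinarith [mul_nonneg this (mul_self_nonneg ((X *ᵥ y) i))]
    have h1 : y ⬝ᵥ (M *ᵥ y) = s * ((X *ᵥ y) ⬝ᵥ (Matrix.diagonal w *ᵥ (X *ᵥ y)))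
        + lam * (y ⬝ᵥ y) := by
      rw [hM, add_mulVec, smul_mulVec, smul_mulVec, one_mulVec, dotProduct_add,
        dotProduct_smul, dotProduct_smul, smul_eq_mul, smul_eq_mul, ← mulVec_mulVec,
        ← mulVec_mulVec, dotProduct_mulVec y Xᵀ, vecMul_transpose]
    rw [h1]
    nlinarith [mul_nonneg hs h0]
  have hU : IsUnit M := by
    rw [← Matrix.mulVec_injective_iff_isUnit]
    rw [← Matrix.coe_mulVecLin, ← LinearMap.ker_eq_bot, LinearMap.ker_eq_bot']
    intro y hy
    have h := hq y
    rw [Matrix.mulVecLin_apply] at hy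
    rw [hy, dotProduct_zero] at h
    have h2 : 0 ≤ y ⬝ᵥ y := Finset.sum_nonneg fun i _ => mul_self_nonneg _
    exact dotProduct_self_eq_zero.mp (by nlinarith)
  refine ⟨hU, fun i j => ?_⟩
  have hL0 : 0 ≤ L := (Real.sqrt_nonneg _).trans (hL i)
  have hX : ∀ i, X i ⬝ᵥ X i ≤ L ^ 2 := by
    intro i
    have := Real.sqrt_le_iff.mp (hL i)
    simpa [dotProduct, sq] using this.2
  set y := M⁻¹ *ᵥ (X j) with hy
  have hMy : M *ᵥ y = X j := by
    rw [hy, mulVec_mulVec, Matrix.mul_nonsing_inv _ ((Matrix.isUnit_iff_isUnit_det _).mp hU),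
      one_mulVec]
  have he : (X * M⁻¹ * Xᵀ) i j = X i ⬝ᵥ y := by
    rw [Matrix.mul_assoc, hy]
    simp only [Matrix.mul_apply, dotProduct, mulVec, transpose_apply]
  have cs : ∀ a b : Fin d → ℝ, (a ⬝ᵥ b) ^ 2 ≤ (a ⬝ᵥ a) * (b ⬝ᵥ b) := by
    intro a b
    have := Finset.sum_mul_sq_le_sq_mul_sq Finset.univ a b
    simpa [dotProduct, sq] using this
  have hyy : 0 ≤ y ⬝ᵥ y := Finset.sum_nonneg fun i _ => mul_self_nonneg _
  have h1 := hq y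
  rw [hMy] at h1
  have h2 := cs y (X j)
  have h3 : lam ^ 2 * (y ⬝ᵥ y) ≤ L ^ 2 := by
    by_cases h0 : y ⬝ᵥ y = 0
    · rw [h0]; nlinarith [sq_nonneg L]
    · have hpos : 0 < y ⬝ᵥ y := lt_of_le_of_ne hyy (Ne.symm h0)
      have h4 : (lam * (y ⬝ᵥ y)) ^ 2 ≤ (y ⬝ᵥ X j) ^ 2 :=
        pow_le_pow_left₀ (by positivity) h1 2
      have h5 : (y ⬝ᵥ y) * (X j ⬝ᵥ X j) ≤ (y ⬝ᵥ y) * L ^ 2 :=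
        mul_le_mul_of_nonneg_left (hX j) hyy
      refine le_of_mul_le_mul_left ?_ hpos
      nlinarith
  rw [he]
  refine abs_le_of_sq_le_sq ?_ (div_nonneg (sq_nonneg L) hlam.le)
  have h6 : (X i ⬝ᵥ X i) * (y ⬝ᵥ y) ≤ L ^ 2 * (y ⬝ᵥ y) :=
    mul_le_mul_of_nonneg_right (hX i) hyy
  have h7 := cs (X i) y
  rw [div_pow, le_div_iff₀ (by positivity)]
  have h8 := mul_le_mul_of_nonneg_left h3 (sq_nonneg L)
  have h9 := mul_le_mul_of_nonneg_left (h7.trans h6) (sq_nonneg lam)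
  nlinarith

lemma aux_trace {n : ℕ} (K : Matrix (Fin n) (Fin n) ℝ) (v : Fin n → ℝ) (C : ℝ) (hC : 0 ≤ C)
    (hK : ∀ i j, |K i j| ≤ C) :
    Matrix.trace (K * Matrix.diagonal v * K * Matrix.diagonal v * K) ≤
      n ^ 2 * C ^ 3 * ∑ i, v i ^ 2 := by
  have h1 : Matrix.trace (K * Matrix.diagonal v * K * Matrix.diagonal v * K) =
      ∑ i, ∑ k, ∑ j, K i j * v j * K j k * v k * K k i := by
    simp only [Matrix.trace, Matrix.diag_apply]
    refine Finset.sum_congr rfl fun i _ => ?_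
    rw [Matrix.mul_apply]
    refine Finset.sum_congr rfl fun k _ => ?_
    rw [Matrix.mul_diagonal, Matrix.mul_apply, Finset.sum_mul, Finset.sum_mul]
    refine Finset.sum_congr rfl fun j _ => ?_
    rw [Matrix.mul_diagonal]
  have h2 : ∀ i j k, K i j * v j * K j k * v k * K k i ≤ C ^ 3 * (|v j| * |v k|) := by
    intro i j k
    refine (le_abs_self _).trans ?_
    simp only [abs_mul]
    calc |K i j| * |v j| * |K j k| * |v k| * |K k i|
        ≤ C * |v j| * C * |v k| * C := by gcongr <;> apply hK
      _ = _ := by ring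
  have hcs : (∑ j, |v j|) ^ 2 ≤ n * ∑ i, v i ^ 2 := by
    have := sq_sum_le_card_mul_sum_sq (s := Finset.univ) (f := fun j => |v j|)
    simpa using this
  rw [h1]
  calc _ ≤ ∑ i : Fin n, ∑ k, ∑ j, C ^ 3 * (|v j| * |v k|) :=
        Finset.sum_le_sum fun i _ => Finset.sum_le_sum fun k _ =>
          Finset.sum_le_sum fun j _ => h2 i j k
    _ = n * C ^ 3 * (∑ j, |v j|) ^ 2 := by
        simp only [← Finset.mul_sum, ← Finset.sum_mul, Finset.sum_const, Finset.card_univ,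
          Fintype.card_fin, nsmul_eq_mul]
        ring
    _ ≤ n * C ^ 3 * (n * ∑ i, v i ^ 2) := by gcongr
    _ = _ := by ring

lemma aux_matrix {n d : ℕ} (T : Matrix (Fin d) (Fin d) ℝ →ₗ[ℝ] ℝ)
    (B : (Fin n → ℝ) →ₗ[ℝ] Matrix (Fin d) (Fin d) ℝ) (c : Matrix (Fin d) (Fin d) ℝ)
    (w v : Fin n → ℝ) (hw : IsUnit (B w + c)) :
    fderiv ℝ (fun u => fderiv ℝ (fun x => T ((B x + c)⁻¹)) u v) w v =
      2 * T ((B w + c)⁻¹ * B v * (B w + c)⁻¹ * B v * (B w + c)⁻¹) := by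
  letI := Matrix.linftyOpNormedRing (n := Fin d) (α := ℝ)
  letI := Matrix.linftyOpNormedAlgebra (n := Fin d) (R := ℝ) (α := ℝ)
  simp only [Matrix.nonsing_inv_eq_ringInverse]
  exact aux_second_deriv T B c w v hw

/-- Assume `‖x_i‖₂ ≤ L` for the rows of `X`. Then
`G(w) = (1/2n)·Tr(X ((1/σ²) Xᵀ D(w) X + λI)⁻¹ Xᵀ)` is smooth on `ℝ₊ⁿ` with smoothness
constant at most `n L⁶/(λ³ σ⁴)`: the quadratic form of its Hessian in any direction `v`
is bounded by `(n L⁶/(λ³ σ⁴))·‖v‖²`, i.e. the maximum eigenvalue of the Hessian is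
bounded by `n L⁶/(λ³ σ⁴)`. -/
theorem bayesian_V_design_smooth {n d : ℕ} (hn : 0 < n)
    (X : Matrix (Fin n) (Fin d) ℝ) (σ lam L : ℝ) (hσ : 0 < σ) (hlam : 0 < lam)
    (hL : ∀ i, Real.sqrt (∑ j, X i j ^ 2) ≤ L) :
    letI G : (Fin n → ℝ) → ℝ := fun w =>
      (1 / (2 * n)) * Matrix.trace
        (X * ((σ ^ 2)⁻¹ • (Xᵀ * Matrix.diagonal w * X) +
            lam • (1 : Matrix (Fin d) (Fin d) ℝ))⁻¹ * Xᵀ)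
    ∀ w : Fin n → ℝ, 0 ≤ w → ∀ v : Fin n → ℝ,
      fderiv ℝ (fun u => fderiv ℝ G u v) w v ≤
        (n * L ^ 6 / (lam ^ 3 * σ ^ 4)) * ∑ i, v i ^ 2 := by
  intro w hw v
  let B : (Fin n → ℝ) →ₗ[ℝ] Matrix (Fin d) (Fin d) ℝ :=
    { toFun := fun w => (σ ^ 2)⁻¹ • (Xᵀ * Matrix.diagonal w * X)
      map_add' := by
        intro a b
        rw [← smul_add, ← Matrix.add_mul, ← Matrix.mul_add, Matrix.diagonal_add]; rfl
      map_smul' := by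
        intro r a
        rw [Matrix.diagonal_smul, Matrix.mul_smul, Matrix.smul_mul, smul_comm]; rfl }
  let T : Matrix (Fin d) (Fin d) ℝ →ₗ[ℝ] ℝ :=
    { toFun := fun Y => (1 / (2 * n)) * Matrix.trace (X * Y * Xᵀ)
      map_add' := by
        intro a b
        rw [Matrix.mul_add, Matrix.add_mul, Matrix.trace_add, mul_add]
      map_smul' := by
        intro r a
        rw [Matrix.mul_smul, Matrix.smul_mul, Matrix.trace_smul]
        simp only [smul_eq_mul, RingHom.id_apply]; ring }
  obtain ⟨hU, hK⟩ := aux_entry X (σ ^ 2)⁻¹ lam L (by positivity) hlam hL w hw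
  have hmain := aux_matrix T B (lam • 1) w v hU
  refine le_of_eq_of_le hmain ?_
  have hL0 : 0 ≤ L := (Real.sqrt_nonneg _).trans (hL ⟨0, hn⟩)
  have htr := aux_trace _ v (L ^ 2 / lam) (by positivity) hK
  set A := ((σ ^ 2)⁻¹ • (Xᵀ * Matrix.diagonal w * X) +
            lam • (1 : Matrix (Fin d) (Fin d) ℝ))⁻¹ with hA
  have hval : T (A * B v * A * B v * A) = (1 / (2 * n)) * ((σ ^ 2)⁻¹ * ((σ ^ 2)⁻¹ *
      Matrix.trace ((X * A * Xᵀ) * Matrix.diagonal v * (X * A * Xᵀ) * Matrix.diagonal v *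
        (X * A * Xᵀ)))) := by
    change (1 / (2 * (n : ℝ))) * Matrix.trace (X * (A * ((σ ^ 2)⁻¹ • (Xᵀ * Matrix.diagonal v * X))
      * A * ((σ ^ 2)⁻¹ • (Xᵀ * Matrix.diagonal v * X)) * A) * Xᵀ) = _
    simp only [Matrix.mul_smul, Matrix.smul_mul, Matrix.trace_smul, smul_eq_mul, Matrix.mul_assoc]
  change 2 * T (A * B v * A * B v * A) ≤ _
  rw [hval]
  have hn' : (0 : ℝ) < n := by exact_mod_cast hn
  calc _ ≤ 2 * ((1 / (2 * n)) * ((σ ^ 2)⁻¹ * ((σ ^ 2)⁻¹ *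
        (n ^ 2 * (L ^ 2 / lam) ^ 3 * ∑ i, v i ^ 2)))) := by gcongr
    _ = _ := by field_simp
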